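/- Let A be an n × n normal matrix over ℂ (AA* = A*A) and let λ be an eigenvalue of A of algebraic multiplicity k, 1 ≤ k ≤ n − 1. Let v₁, …, v_k be an orthonormal basis of ker(A − λI) and set v = v₁ ∧ ⋯ ∧ v_k ∈ ℂ^C(n,k) (Plücker coordinates). Then adj_k(A − λI) = ((−1)^k P⁽ᵏ⁾(λ) / k!) · v v*, where P(t) = det(A − tI) is the characteristic polynomial of A and v* denotes the conjugate transpose of v. -/

import Mathlib

open Matrix

variable {K : Type*}

/-- The `k`-th compound matrix of an `m × n` matrix `A`: it is indexed by the
`k`-element subsets of the row/column index sets (which correspond to `Fin (choose _ k)`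
via the lexicographic order), and its `(S, T)` entry is the `k × k` minor of `A`
on rows `S` and columns `T`. -/
def compound [CommRing K] {m n : ℕ} (k : ℕ) (A : Matrix (Fin m) (Fin n) K) :
    Matrix {s : Finset (Fin m) // s.card = k} {t : Finset (Fin n) // t.card = k} K :=
  fun S T => (A.submatrix (S.1.orderEmbOfFin S.2) (T.1.orderEmbOfFin T.2)).det

/-- The `k`-th adjugate of an `n × n` matrix `A` (generalizing the classical adjugate,
which is the case `k = 1`): its `(S, T)` entry is `(-1) ^ (Σ S + Σ T)` times the
`(n-k) × (n-k)` minor of `A` obtained by deleting the rows indexed by `T` and the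
columns indexed by `S`.  (The sums `Σ S`, `Σ T` are taken with 1-based indexing in the
classical formula; with 0-based indexing the parity is unchanged.) -/
def adjCompound [CommRing K] {n : ℕ} (k : ℕ) (A : Matrix (Fin n) (Fin n) K) :
    Matrix {s : Finset (Fin n) // s.card = k} {t : Finset (Fin n) // t.card = k} K :=
  fun S T =>
    (-1 : K) ^ ((∑ i ∈ S.1, (i : ℕ)) + (∑ j ∈ T.1, (j : ℕ))) *
      (A.submatrix
        ((T.1ᶜ).orderEmbOfFin (show (T.1ᶜ).card = n - k by
          simp [Finset.card_compl, T.2]))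
        ((S.1ᶜ).orderEmbOfFin (show (S.1ᶜ).card = n - k by
          simp [Finset.card_compl, S.2]))).det

/-- The Plücker coordinates of `x₁ ∧ ⋯ ∧ x_k ∈ ℂ^(choose n k)`: the coordinate at the
`k`-element subset `S` is the `k × k` minor of the `n × k` matrix `[x₁ ⋯ x_k]` on rows `S`. -/
def wedgeVec [CommRing K] {n k : ℕ} (x : Fin k → Fin n → K) :
    {s : Finset (Fin n) // s.card = k} → K :=
  fun S => (Matrix.of fun (i j : Fin k) => x j (S.1.orderEmbOfFin S.2 i)).det

/-- The characteristic polynomial `P(t) = det (A - t I)`. -/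
noncomputable def detPoly [CommRing K] {n : ℕ} (A : Matrix (Fin n) (Fin n) K) : Polynomial K :=
  ((Matrix.of fun i j => Polynomial.C (A i j)) - (Polynomial.X : Polynomial K) • 1).det

lemma swap_lt_swap_of_adjacent {n : ℕ} {i j : Fin n} (hij : (j : ℕ) = i + 1)
    {a b : Fin n} (hab : a < b) (h : ¬ (a = i ∧ b = j)) :
    Equiv.swap i j a < Equiv.swap i j b := by
  simp only [Equiv.swap_apply_def, Fin.lt_def, Fin.ext_iff] at *
  split_ifs <;> omega

lemma orderEmbOfFin_map_swap {n m : ℕ} {i j : Fin n} (hij : (j : ℕ) = i + 1)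
    {S S' : Finset (Fin n)} (hS : S.card = m) (hS' : S'.card = m)
    (hmap : ∀ x ∈ S, Equiv.swap i j x ∈ S') (h : ¬ (i ∈ S ∧ j ∈ S)) (a : Fin m) :
    S'.orderEmbOfFin hS' a = Equiv.swap i j (S.orderEmbOfFin hS a) := by
  refine (congrFun (Finset.orderEmbOfFin_unique hS'
    (f := fun a => Equiv.swap i j (S.orderEmbOfFin hS a))
    (fun x => hmap _ (Finset.orderEmbOfFin_mem _ _ _)) fun a b hab => ?_) a).symm
  refine swap_lt_swap_of_adjacent hij ((S.orderEmbOfFin hS).strictMono hab) ?_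
  rintro ⟨h1, h2⟩
  exact h ⟨h1 ▸ Finset.orderEmbOfFin_mem _ _ _, h2 ▸ Finset.orderEmbOfFin_mem _ _ _⟩

lemma sign_finSumEquivOfFinset_of_isLowerSet {n k m : ℕ} {T : Finset (Fin n)} (hT : T.card = k)
    (hT' : Tᶜ.card = m) (hlow : IsLowerSet (T : Set (Fin n))) (S : Finset (Fin n))
    (hS : S.card = k) (hS' : Sᶜ.card = m) :
    ((Equiv.Perm.sign ((finSumEquivOfFinset hS hS').trans (finSumEquivOfFinset hT hT').symm) : ℤˣ)
      : ℤ) = (-1) ^ ((∑ i ∈ S, (i : ℕ)) + ∑ j ∈ T, (j : ℕ)) := by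
  induction hN : ∑ i ∈ S, (i : ℕ) using Nat.strong_induction_on generalizing S with
  | _ N ih =>
  by_cases hSlow : IsLowerSet (S : Set (Fin n))
  · have : S = T := by
      rcases hSlow.total hlow with h | h
      · exact Finset.eq_of_subset_of_card_le (by exact_mod_cast h) (by omega)
      · exact (Finset.eq_of_subset_of_card_le (by exact_mod_cast h) (by omega)).symm
    subst this
    simp [← hN, ← two_mul]
  · obtain ⟨i, j, hij, hj, hi⟩ : ∃ i j : Fin n, (j : ℕ) = i + 1 ∧ j ∈ S ∧ i ∉ S := by
      by_contra! hcon
      apply hSlow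
      have key : ∀ d : ℕ, ∀ a b : Fin n, (b : ℕ) + d = a → a ∈ S → b ∈ S := by
        intro d
        induction d with
        | zero => intro a b h ha; rwa [show b = a from Fin.ext h]
        | succ d ihd =>
          intro a b h ha
          exact hcon b ⟨b + 1, by omega⟩ rfl (ihd a ⟨b + 1, by omega⟩ (by simp; omega) ha)
      intro a b hba ha
      exact key (a - b) a b (by have : (b : ℕ) ≤ a := hba; omega) ha
    have hne : i ≠ j := by rintro rfl; omega
    set S' := insert i (S.erase j) with hS'def
    have hi' : i ∉ S.erase j := fun h => hi (Finset.mem_of_mem_erase h)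
    have hcard : S'.card = k := by
      rw [Finset.card_insert_of_notMem hi', Finset.card_erase_add_one hj, hS]
    have hcard' : S'ᶜ.card = m := by
      rw [← hS', Finset.card_compl, Finset.card_compl, hcard, hS]
    have hsum : (∑ x ∈ S, (x : ℕ)) = (∑ x ∈ S', (x : ℕ)) + 1 := by
      rw [Finset.sum_insert hi', ← Finset.add_sum_erase S _ hj]; omega
    have hmem : ∀ x, Equiv.swap i j x ∈ S' ↔ x ∈ S := by
      intro x
      rw [Equiv.swap_apply_def]
      split_ifs with h1 h2 <;> simp [hS'def] <;> grind
    have hσ : finSumEquivOfFinset hS hS' =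
        (finSumEquivOfFinset hcard hcard').trans (Equiv.swap i j) := by
      ext (a | a)
      · simp [orderEmbOfFin_map_swap hij hS hcard (fun x hx => (hmem x).2 hx) (fun h => hi h.1)]
      · simp [orderEmbOfFin_map_swap hij hS' hcard'
          (fun x hx => by rw [Finset.mem_compl, hmem]; simpa using hx)
          (fun h => (Finset.mem_compl.1 h.2) hj)]
    have := ih _ (by omega) S' hcard hcard' rfl
    have hperm : (finSumEquivOfFinset hS hS').trans (finSumEquivOfFinset hT hT').symm =
        ((finSumEquivOfFinset hcard hcard').trans (finSumEquivOfFinset hT hT').symm).trans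
        (((finSumEquivOfFinset hT hT').trans (Equiv.swap i j)).trans
          (finSumEquivOfFinset hT hT').symm) := by
      rw [hσ]; ext x; simp only [Equiv.trans_apply, Equiv.apply_symm_apply]
    rw [hperm, Equiv.Perm.sign_trans, Equiv.Perm.sign_trans_trans_symm, Equiv.Perm.sign_swap hne]
    rw [← hN, hsum]
    push_cast
    rw [this]
    ring

lemma sign_finSumEquivOfFinset {n k m : ℕ} {S T : Finset (Fin n)} (hS : S.card = k)
    (hS' : Sᶜ.card = m) (hT : T.card = k) (hT' : Tᶜ.card = m) :
    ((Equiv.Perm.sign ((finSumEquivOfFinset hS hS').trans (finSumEquivOfFinset hT hT').symm) : ℤˣ)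
      : ℤ) = (-1) ^ ((∑ i ∈ S, (i : ℕ)) + ∑ j ∈ T, (j : ℕ)) := by
  have hkn : k ≤ n := by simpa [hS] using S.card_le_univ
  set L : Finset (Fin n) := Finset.univ.map (Fin.castLEEmb hkn) with hLdef
  have hL : L.card = k := by simp [hLdef]
  have hL' : Lᶜ.card = m := by rw [← hS', Finset.card_compl, Finset.card_compl, hL, hS]
  have hlow : IsLowerSet (L : Set (Fin n)) := by
    intro a b hba ha
    simp only [hLdef, Finset.coe_map, Finset.coe_univ, Set.image_univ, Set.mem_range] at ha ⊢
    obtain ⟨x, rfl⟩ := ha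
    exact ⟨⟨b, lt_of_le_of_lt (Fin.le_def.1 hba) x.2⟩, rfl⟩
  have h1 := sign_finSumEquivOfFinset_of_isLowerSet hL hL' hlow S hS hS'
  have h2 := sign_finSumEquivOfFinset_of_isLowerSet hL hL' hlow T hT hT'
  have hperm : (finSumEquivOfFinset hS hS').trans (finSumEquivOfFinset hT hT').symm =
      ((finSumEquivOfFinset hS hS').trans (finSumEquivOfFinset hL hL').symm).trans
        ((finSumEquivOfFinset hT hT').trans (finSumEquivOfFinset hL hL').symm).symm := by
    ext x; simp
  rw [hperm, Equiv.Perm.sign_trans, Equiv.Perm.sign_symm]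
  push_cast
  rw [h1, h2, ← pow_add, show ∀ a b c : ℕ, b + c + (a + c) = a + b + 2 * c by intros; ring,
    pow_add _ _ (2 * _), pow_mul]
  simp

lemma det_fromBlocks_zero_one_one_zero {R : Type*} [CommRing R] {m : Type*} [Fintype m]
    [DecidableEq m] : (fromBlocks 0 1 1 0 : Matrix (m ⊕ m) (m ⊕ m) R).det =
      (-1) ^ Fintype.card m := by
  have h : (fromBlocks 0 1 1 0 : Matrix (m ⊕ m) (m ⊕ m) R) * fromBlocks 1 0 1 1 =
      fromBlocks 1 1 1 0 := by
    simp [fromBlocks_multiply]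
  have h' := congrArg det h
  rw [det_mul, det_fromBlocks_zero₁₂, det_fromBlocks_one₁₁] at h'
  simpa [det_neg] using h'

lemma det_fromBlocks_zero₂₂ {R : Type*} [CommRing R] {m : Type*} [Fintype m] [DecidableEq m]
    (X Y Z : Matrix m m R) :
    (fromBlocks X Y Z 0).det = (-1) ^ Fintype.card m * (Y.det * Z.det) := by
  have h : fromBlocks X Y Z 0 = fromBlocks Y X 0 Z * fromBlocks 0 1 1 0 := by
    simp [fromBlocks_multiply]
  rw [h, det_mul, det_fromBlocks_zero₂₁, det_fromBlocks_zero_one_one_zero]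
  ring

lemma det_fromBlocks_fromRows_fromCols_one {R : Type*} [CommRing R] {m p : Type*} [Fintype m]
    [DecidableEq m] [Fintype p] [DecidableEq p] (a : Matrix m m R) (b : Matrix m p R)
    (c : Matrix p m R) (d : Matrix p p R) :
    (fromBlocks (fromBlocks a b c d) (fromRows 1 0) (fromCols 1 0) (0 : Matrix m m R)).det =
      (-1) ^ Fintype.card m * d.det := by
  let e : (m ⊕ m) ⊕ p ≃ (m ⊕ p) ⊕ m :=
    (Equiv.sumAssoc m m p).trans
      (((Equiv.refl m).sumCongr (Equiv.sumComm m p)).trans (Equiv.sumAssoc m p m).symm)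
  let P : Matrix (m ⊕ m) (m ⊕ m) R := fromBlocks a 1 1 0
  let P' : Matrix (m ⊕ m) (m ⊕ m) R := fromBlocks 0 1 1 (-a)
  let : Invertible P := ⟨P', by simp [P, P', fromBlocks_multiply],
    by simp [P, P', fromBlocks_multiply]⟩
  have hsub : (fromBlocks (fromBlocks a b c d) (fromRows 1 0) (fromCols 1 0)
      (0 : Matrix m m R)).submatrix e e = fromBlocks P (fromRows b 0) (fromCols c 0) d := by
    ext ((i | i) | i) ((j | j) | j) <;> simp [e, P]
  have hinv : ⅟P = P' := rfl
  rw [← det_submatrix_equiv_self e, hsub, det_fromBlocks₁₁, hinv, det_fromBlocks_zero₂₂]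
  simp [P', fromCols_mul_fromBlocks, fromCols_mul_fromRows]

/-- Bordering a matrix by the standard basis vectors indexed by `S` and `T` computes, up to sign,
the minor obtained by deleting the rows in `T` and the columns in `S`. -/
lemma det_fromBlocks_orderEmbOfFin {R : Type*} [CommRing R] {n k m : ℕ}
    (B : Matrix (Fin n) (Fin n) R) {S T : Finset (Fin n)} (hS : S.card = k) (hS' : Sᶜ.card = m)
    (hT : T.card = k) (hT' : Tᶜ.card = m) :
    (fromBlocks B ((1 : Matrix (Fin n) (Fin n) R).submatrix id (T.orderEmbOfFin hT))
      ((1 : Matrix (Fin n) (Fin n) R).submatrix (S.orderEmbOfFin hS) id) 0).det =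
    (-1) ^ k * ((-1) ^ ((∑ i ∈ S, (i : ℕ)) + ∑ j ∈ T, (j : ℕ)) *
      (B.submatrix (Tᶜ.orderEmbOfFin hT') (Sᶜ.orderEmbOfFin hS')).det) := by
  set M := fromBlocks B ((1 : Matrix (Fin n) (Fin n) R).submatrix id (T.orderEmbOfFin hT))
      ((1 : Matrix (Fin n) (Fin n) R).submatrix (S.orderEmbOfFin hS) id) 0 with hM
  let σ := finSumEquivOfFinset hS hS'
  let τ := finSumEquivOfFinset hT hT'
  have hsub : M.submatrix (τ.sumCongr (Equiv.refl (Fin k))) (σ.sumCongr (Equiv.refl (Fin k))) =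
      fromBlocks (fromBlocks (B.submatrix (T.orderEmbOfFin hT) (S.orderEmbOfFin hS))
        (B.submatrix (T.orderEmbOfFin hT) (Sᶜ.orderEmbOfFin hS'))
        (B.submatrix (Tᶜ.orderEmbOfFin hT') (S.orderEmbOfFin hS))
        (B.submatrix (Tᶜ.orderEmbOfFin hT') (Sᶜ.orderEmbOfFin hS')))
        (fromRows 1 0) (fromCols 1 0) 0 := by
    have hne : ∀ (U : Finset (Fin n)) (hU : U.card = k) (hU' : Uᶜ.card = m) (x : Fin k)
        (y : Fin m), U.orderEmbOfFin hU x ≠ Uᶜ.orderEmbOfFin hU' y := by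
      intro U hU hU' x y h
      have h1 := Finset.orderEmbOfFin_mem Uᶜ hU' y
      rw [← h, Finset.mem_compl] at h1
      exact h1 (Finset.orderEmbOfFin_mem U hU x)
    ext ((i | i) | i) ((j | j) | j) <;>
      simp [hM, σ, τ, one_apply, hne, (hne _ _ _ _ _).symm]
  have hperm : M.submatrix (τ.sumCongr (Equiv.refl (Fin k))) (σ.sumCongr (Equiv.refl (Fin k))) =
      (M.submatrix (τ.sumCongr (Equiv.refl (Fin k)))
        (τ.sumCongr (Equiv.refl (Fin k)))).submatrix id
        (Equiv.Perm.sumCongr (σ.trans τ.symm) (1 : Equiv.Perm (Fin k))) := by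
    ext i (j | j) <;> simp
  have hdet := congrArg det hperm
  rw [hsub, det_fromBlocks_fromRows_fromCols_one, det_permute', det_submatrix_equiv_self,
    Equiv.Perm.sign_sumCongr, Equiv.Perm.sign_one, mul_one, sign_finSumEquivOfFinset,
    Fintype.card_fin] at hdet
  push_cast at hdet
  rw [mul_left_comm, hdet, ← mul_assoc, ← pow_add, ← two_mul, pow_mul]
  simp

/-- If `C` fixes the columns of `V` and the rows of `W`, and `W * V = 1`, then the bordered
determinant of the deflation `C - V * W` factors. -/
lemma det_fromBlocks_sub_mul {R : Type*} [CommRing R] {m p : Type*} [Fintype m] [DecidableEq m]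
    [Fintype p] [DecidableEq p] (C : Matrix m m R) [Invertible C] (V : Matrix m p R)
    (W : Matrix p m R) (hCV : C * V = V) (hWC : W * C = W) (hWV : W * V = 1)
    (E : Matrix m p R) (F : Matrix p m R) :
    (fromBlocks (C - V * W) E F 0).det =
      (-1) ^ Fintype.card p * (C.det * ((F * V).det * (W * E).det)) := by
  have hV : ⅟C * V = V := by
    nth_rw 1 [← hCV]; rw [← Matrix.mul_assoc, invOf_mul_self, Matrix.one_mul]
  have hW : W * ⅟C = W := by
    nth_rw 1 [← hWC]; rw [Matrix.mul_assoc, mul_invOf_self, Matrix.mul_one]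
  have hsub : (fromBlocks C (fromCols E V) (fromRows F W) (fromBlocks 0 0 0 1)).submatrix
      (Equiv.sumAssoc m p p) (Equiv.sumAssoc m p p) =
      fromBlocks (fromBlocks C E F 0) (fromRows V 0) (fromCols W 0) 1 := by
    ext ((i | i) | i) ((j | j) | j) <;> simp
  have h := congrArg det hsub
  rw [det_submatrix_equiv_self, det_fromBlocks_one₂₂, fromRows_mul_fromCols, det_fromBlocks₁₁,
    Matrix.mul_assoc, mul_fromCols, fromRows_mul_fromCols, hV] at h
  have h1 : fromBlocks C E F 0 - fromBlocks (V * W) (V * (0 : Matrix p p R))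
      ((0 : Matrix p p R) * W) ((0 : Matrix p p R) * (0 : Matrix p p R)) =
      fromBlocks (C - V * W) E F 0 := by
    ext (i | i) (j | j) <;> simp
  have h2 : fromBlocks 0 0 0 1 - fromBlocks (F * (⅟C * E)) (F * V) (W * (⅟C * E)) (W * V) =
      -fromBlocks (F * (⅟C * E)) (F * V) (W * E) 0 := by
    rw [← Matrix.mul_assoc W, hW, hWV]
    ext (i | i) (j | j) <;> simp
  rw [h1, h2, det_neg, det_fromBlocks_zero₂₂] at h
  rw [← h, Fintype.card_sum, ← two_mul, pow_mul]
  simp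
  ring

lemma eval_detPoly [CommRing K] {n : ℕ} (A : Matrix (Fin n) (Fin n) K) (t : K) :
    (detPoly A).eval t = (A - t • 1).det := by
  rw [detPoly, ← Polynomial.coe_evalRingHom, RingHom.map_det]
  congr 1
  ext i j
  by_cases h : i = j <;> simp [one_apply, h]

lemma pow_mul_detPoly_add_mul {F : Type*} [Field F] [Infinite F] {n k : ℕ}
    (A : Matrix (Fin n) (Fin n) F) (lam : F)
    (V : Matrix (Fin n) (Fin k) F) (W : Matrix (Fin k) (Fin n) F)
    (hAV : (A - lam • 1) * V = 0) (hWV : W * V = 1) :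
    (Polynomial.X - Polynomial.C lam) ^ k * detPoly (A + V * W) =
      detPoly A * (Polynomial.X - Polynomial.C lam - 1) ^ k := by
  refine mul_left_cancel₀ (pow_ne_zero n (Polynomial.X_sub_C_ne_zero lam)) ?_
  refine Polynomial.funext fun t => ?_
  simp only [Polynomial.eval_mul, Polynomial.eval_pow, Polynomial.eval_sub, Polynomial.eval_X,
    Polynomial.eval_C, Polynomial.eval_one, eval_detPoly]
  have hAV' : A * (V * W) = lam • (V * W) := by
    rw [Matrix.sub_mul, sub_eq_zero, Matrix.smul_mul, Matrix.one_mul] at hAV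
    rw [← Matrix.mul_assoc, hAV, Matrix.smul_mul]
  have hscalar : scalar (Fin n) (t - lam) = (t - lam) • (1 : Matrix (Fin n) (Fin n) F) := by
    rw [scalar_apply, smul_one_eq_diagonal]
  have hfac : (t - lam) • (A + V * W - t • 1) =
      (A - t • 1) * (scalar (Fin n) (t - lam) - V * W) := by
    rw [Matrix.mul_sub, Matrix.sub_mul (M := A), Matrix.sub_mul (M := A), hAV',
      hscalar]
    simp only [Matrix.smul_mul, Matrix.mul_smul, Matrix.one_mul, Matrix.mul_one]
    module
  have hdet := congrArg det hfac
  have hchar := congrArg (Polynomial.eval (t - lam)) (charpoly_mul_comm' V W)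
  rw [det_mul, det_smul, ← eval_charpoly] at hdet
  rw [hWV] at hchar
  simp [charpoly_one] at hchar hdet
  linear_combination (t - lam) ^ k * hdet + (A - t • 1).det * hchar

open scoped ComplexOrder in
/-- The kernel of a normal matrix is annihilated by its conjugate transpose. -/
lemma conjTranspose_mul_eq_zero_of_normal {m p : Type*} [Fintype m] [Fintype p]
    {B : Matrix m m ℂ} (hB : B * Bᴴ = Bᴴ * B) {V : Matrix m p ℂ} (hV : B * V = 0) :
    Vᴴ * B = 0 := by
  have h : (Bᴴ * V)ᴴ * (Bᴴ * V) = 0 := by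
    rw [conjTranspose_mul, conjTranspose_conjTranspose, Matrix.mul_assoc, ← Matrix.mul_assoc B,
      hB, Matrix.mul_assoc, hV]
    simp
  simpa using congrArg conjTranspose (conjTranspose_mul_self_eq_zero.1 h)

/-- Let `A` be an `n × n` normal complex matrix and `λ` an eigenvalue of `A` of algebraic
multiplicity `k`, `1 ≤ k ≤ n - 1`.  If `v₁, …, v_k` is an orthonormal basis of
`ker (A - λI)` and `v = v₁ ∧ ⋯ ∧ v_k` (Plücker coordinates), then
`adj_k (A - λI) = ((-1)^k P⁽ᵏ⁾(λ) / k!) • v v*` where `P(t) = det (A - tI)`. -/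
theorem adjCompound_normal_eigenvector_identity
    {n : ℕ} (A : Matrix (Fin n) (Fin n) ℂ) (hA : A * Aᴴ = Aᴴ * A)
    (lam : ℂ) {k : ℕ} (hk1 : 1 ≤ k) (hk2 : k ≤ n - 1)
    (halg : (detPoly A).rootMultiplicity lam = k)
    (v : Fin k → Fin n → ℂ)
    (hv : ∀ i, (A - lam • 1) *ᵥ v i = 0)
    (hspan : Submodule.span ℂ (Set.range v) = LinearMap.ker (A - lam • 1).mulVecLin)
    (horth : ∀ i j, star (v i) ⬝ᵥ v j = if i = j then 1 else 0) :
    adjCompound k (A - lam • 1) =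
      ((-1 : ℂ) ^ k * (Polynomial.derivative^[k] (detPoly A)).eval lam /
          (Nat.factorial k : ℂ)) •
        Matrix.vecMulVec (wedgeVec v) (star (wedgeVec v)) := by
  set V : Matrix (Fin n) (Fin k) ℂ := Matrix.of fun i j => v j i with hVdef
  have hBV : (A - lam • 1) * V = 0 := by
    ext i j
    exact congrFun (hv j) i
  have hWV : Vᴴ * V = 1 := by
    ext i j
    rw [one_apply, ← horth i j]
    rfl
  have hnormal : (A - lam • 1) * (A - lam • 1)ᴴ = (A - lam • 1)ᴴ * (A - lam • 1) := by
    simp only [conjTranspose_sub, conjTranspose_smul, conjTranspose_one, Matrix.sub_mul,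
      Matrix.mul_sub, hA, Matrix.smul_mul, Matrix.mul_smul, Matrix.one_mul, Matrix.mul_one]
    module
  have hWB := conjTranspose_mul_eq_zero_of_normal hnormal hBV
  have hCV : (A - lam • 1 + V * Vᴴ) * V = V := by
    rw [Matrix.add_mul, hBV, Matrix.mul_assoc, hWV, Matrix.mul_one, zero_add]
  have hWC : Vᴴ * (A - lam • 1 + V * Vᴴ) = Vᴴ := by
    rw [Matrix.mul_add, hWB, ← Matrix.mul_assoc, hWV, Matrix.one_mul, zero_add]
  have hunit : IsUnit (A - lam • 1 + V * Vᴴ) := by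
    rw [← mulVec_injective_iff_isUnit, ← coe_mulVecLin, injective_iff_map_eq_zero]
    intro x hx
    rw [mulVecLin_apply] at hx
    have hWx : Vᴴ *ᵥ x = 0 := by
      rw [← hWC, ← mulVec_mulVec, hx, mulVec_zero]
    have hBx : x ∈ LinearMap.ker (A - lam • 1).mulVecLin := by
      rw [add_mulVec, ← mulVec_mulVec, hWx, mulVec_zero, add_zero] at hx
      exact hx
    rw [← hspan, show v = V.col from rfl, ← range_mulVecLin] at hBx
    obtain ⟨y, rfl⟩ := hBx
    rw [mulVecLin_apply, mulVec_mulVec, hWV, one_mulVec] at hWx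
    simp [hWx]
  obtain ⟨_⟩ := hunit.nonempty_invertible
  have hscalar : (-1 : ℂ) ^ k * (Polynomial.derivative^[k] (detPoly A)).eval lam /
      (Nat.factorial k : ℂ) = (A - lam • 1 + V * Vᴴ).det := by
    have hpoly := pow_mul_detPoly_add_mul A lam V Vᴴ hBV hWV
    have hder := Polynomial.eval_iterate_derivative_rootMultiplicity (p := detPoly A) (t := lam)
    have hdiv := Polynomial.pow_mul_divByMonic_rootMultiplicity_eq (detPoly A) lam
    rw [halg] at hder hdiv
    rw [← hdiv, mul_assoc] at hpoly
    have heval := congrArg (Polynomial.eval lam)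
      (mul_left_cancel₀ (pow_ne_zero k (Polynomial.X_sub_C_ne_zero lam)) hpoly)
    simp only [eval_detPoly, Polynomial.eval_mul, Polynomial.eval_pow, Polynomial.eval_sub,
      Polynomial.eval_X, Polynomial.eval_C, Polynomial.eval_one, sub_self, zero_sub] at heval
    rw [sub_add_eq_add_sub, heval, hder, nsmul_eq_mul]
    field_simp [Nat.factorial_ne_zero]
  rw [hscalar]
  ext S T
  have hminor := det_fromBlocks_orderEmbOfFin (A - lam • 1) S.2
    (show S.1ᶜ.card = n - k by simp [Finset.card_compl, S.2]) T.2
    (show T.1ᶜ.card = n - k by simp [Finset.card_compl, T.2])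
  have hfactor := det_fromBlocks_sub_mul (A - lam • 1 + V * Vᴴ) V Vᴴ hCV hWC hWV
    ((1 : Matrix (Fin n) (Fin n) ℂ).submatrix id (T.1.orderEmbOfFin T.2))
    ((1 : Matrix (Fin n) (Fin n) ℂ).submatrix (S.1.orderEmbOfFin S.2) id)
  simp only [add_sub_cancel_right, hminor, Fintype.card_fin] at hfactor
  have hS : (1 : Matrix (Fin n) (Fin n) ℂ).submatrix (S.1.orderEmbOfFin S.2) id * V =
      Matrix.of fun i j => v j (S.1.orderEmbOfFin S.2 i) := by
    ext i j
    simp [mul_apply, one_apply, hVdef]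
  have hT : Vᴴ * (1 : Matrix (Fin n) (Fin n) ℂ).submatrix id (T.1.orderEmbOfFin T.2) =
      (Matrix.of fun i j => v j (T.1.orderEmbOfFin T.2 i))ᴴ := by
    ext i j
    simp [mul_apply, one_apply, hVdef]
  rw [hS, hT, det_conjTranspose] at hfactor
  exact mul_left_cancel₀ (pow_ne_zero k (neg_ne_zero.2 one_ne_zero)) hfactor
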